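/- arXiv:2308.01753 — 2 statements merged into one kernel-verified Lean document; each statement's English description precedes it below -/
import Mathlib

section
/- Let N ≥ 1 and γ ≥ 0. Then every 𝓑 ∈ 𝒞^γ satisfies sup_{p ∈ 𝓑} ‖p‖ ≤ 4√N(‖C‖_∞ + γ). -/
open MeasureTheory Metric Set TopologicalSpace Filter
open scoped RealInnerProductSpace NNReal ENNReal

noncomputable section

abbrev Euc (N : ℕ) := EuclideanSpace ℝ (Fin N)

/-- The outreach (support) function of a set. -/
def outreach {N : ℕ} (B : Set (Euc N)) (u : Euc N) : ℝ :=
  sSup ((fun b => ⟪b, u⟫) '' B)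

/-- The half-space `Π⁻(u,b)`. -/
def halfSpace {N : ℕ} (u : Euc N) (b : ℝ) : Set (Euc N) := {x | ⟪u, x⟫ ≤ b}

/-- The uniform probability measure on the unit sphere. -/
def sphereMeasure (N : ℕ) : Measure (Metric.sphere (0 : Euc N) 1) :=
  (((volume : Measure (Euc N)).toSphere) Set.univ)⁻¹ • ((volume : Measure (Euc N)).toSphere)

/-- The sup-norm of a function restricted to the unit sphere. -/
def supNormSphere {N : ℕ} (f : Euc N → ℝ) : ℝ :=
  ⨆ x : Metric.sphere (0 : Euc N) 1, |f x|

/-- The dispersion of a set of directions. -/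
def dispersion {N : ℕ} (S : Set (Euc N)) : ℝ :=
  ⨆ u : Metric.sphere (0 : Euc N) 1, ⨅ v : S, ‖(u : Euc N) - (v : Euc N)‖

/-- `ε`-accurate quadrature on the unit sphere. -/
def IsAccurateQuadrature {N : ℕ} {ι : Type*} [Fintype ι]
    (u : ι → Euc N) (w : ι → ℝ) (ε : ℝ) : Prop :=
  (∀ i, u i ∈ Metric.sphere (0 : Euc N) 1) ∧ (∀ i, 0 ≤ w i) ∧
  ∀ (L : ℝ≥0) (f : Euc N → ℝ), LipschitzOnWith L f (Metric.sphere (0 : Euc N) 1) →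
    |(∫ x : Metric.sphere (0 : Euc N) 1, f x ∂(sphereMeasure N)) - ∑ i, w i * f (u i)|
      ≤ ε * (L + supNormSphere f)

/-- Halved mean width. -/
def meanHalfWidth {N : ℕ} (B : Set (Euc N)) : ℝ :=
  ∫ u : Metric.sphere (0 : Euc N) 1, outreach B (u : Euc N) ∂(sphereMeasure N)

/-- Feasible solutions of the continuous problem. -/
def CInf {N : ℕ} (C : Euc N → ℝ) : Set (Set (Euc N)) :=
  {B | B.Nonempty ∧ Convex ℝ B ∧ IsCompact B ∧
    ∀ u ∈ Metric.sphere (0 : Euc N) 1, C u ≤ outreach B u}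

/-- Optimal value of the continuous problem. -/
def VCP {N : ℕ} (C : Euc N → ℝ) : ℝ := sInf (meanHalfWidth '' CInf C)

/-- `γ`-near optimal solutions of the continuous problem. -/
def CGamma {N : ℕ} (C : Euc N → ℝ) (γ : ℝ) : Set (Set (Euc N)) :=
  {B ∈ CInf C | meanHalfWidth B - VCP C ≤ γ}

/-- Feasible solutions of the discrete problem with node set `S`. -/
def DInf {N : ℕ} (C : Euc N → ℝ) (S : Set (Euc N)) : Set (Set (Euc N)) :=
  {B | B.Nonempty ∧ Convex ℝ B ∧ IsCompact B ∧ ∀ u ∈ S, C u ≤ outreach B u}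

/-- Discrete objective. -/
def quadSum {N : ℕ} {ι : Type*} [Fintype ι] (u : ι → Euc N) (w : ι → ℝ)
    (B : Set (Euc N)) : ℝ :=
  ∑ i, w i * outreach B (u i)

/-- Optimal value of the discrete problem. -/
def VDP {N : ℕ} {ι : Type*} [Fintype ι] (u : ι → Euc N) (w : ι → ℝ) (C : Euc N → ℝ) : ℝ :=
  sInf (quadSum u w '' DInf C (Set.range u))

/-- `γ`-near optimal solutions of the discrete problem. -/
def DGamma {N : ℕ} {ι : Type*} [Fintype ι] (u : ι → Euc N) (w : ι → ℝ) (C : Euc N → ℝ)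
    (γ : ℝ) : Set (Set (Euc N)) :=
  {B ∈ DInf C (Set.range u) | quadSum u w B - VDP u w C ≤ γ}

theorem polar_aux {N : ℕ} (a : Metric.sphere (0 : Euc N) 1 → ℝ) (g : ℝ → ℝ) (F : Euc N → ℝ)
    (hF : ∀ (u : Metric.sphere (0 : Euc N) 1) (r : ℝ), 0 < r → F (r • (u : Euc N)) = a u * g r)
    (hN : 1 ≤ N) :
    ∫ x, F x = (∫ u, a u ∂(volume : Measure (Euc N)).toSphere) *
      ∫ y in Ioi (0 : ℝ), y ^ (N - 1) * g y := by
  have : Nonempty (Fin N) := ⟨⟨0, hN⟩⟩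
  have h1 : ∫ x, F x = ∫ x : ({(0)}ᶜ : Set (Euc N)), F x.1 ∂((volume : Measure (Euc N)).comap (Subtype.val : ({(0)}ᶜ : Set (Euc N)) → Euc N)) := by
    rw [integral_subtype_comap (measurableSet_singleton _).compl F,
        restrict_compl_singleton]
  have hd : Module.finrank ℝ (Euc N) = N := by simp
  have h2 := (volume : Measure (Euc N)).measurePreserving_homeomorphUnitSphereProd.integral_comp
        (Homeomorph.measurableEmbedding _) (fun p => a p.1 * g p.2.1)
  rw [h1]
  have h3 : ∀ x : ({(0)}ᶜ : Set (Euc N)), F x.1 =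
      a (homeomorphUnitSphereProd (Euc N) x).1 * g (homeomorphUnitSphereProd (Euc N) x).2.1 := by
    intro x
    rw [← hF _ _ (homeomorphUnitSphereProd (Euc N) x).2.2]
    congr 1
    have hx : ‖(x : Euc N)‖ ≠ 0 := by
      exact norm_ne_zero_iff.mpr x.2
    simp [homeomorphUnitSphereProd_apply_fst_coe, homeomorphUnitSphereProd_apply_snd_coe, smul_smul, hx]
  simp_rw [h3]
  rw [h2, integral_prod_mul (f := a) (g := fun r : Ioi (0 : ℝ) => g r.1), hd]
  congr 1
  simp only [Measure.volumeIoiPow, ENNReal.ofReal]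
  rw [integral_withDensity_eq_integral_smul,
    integral_subtype_comap measurableSet_Ioi fun a ↦ Real.toNNReal (a ^ (N - 1)) • g a,
    setIntegral_congr_fun measurableSet_Ioi fun x hx ↦ ?_]
  · rw [NNReal.smul_def, Real.coe_toNNReal _ (pow_nonneg hx.out.le _), smul_eq_mul]
  · exact (measurable_subtype_coe.pow_const _).real_toNNReal

theorem radial_gauss (k : ℕ) :
    ∫ y in Ioi (0 : ℝ), y ^ k * Real.exp (-y ^ 2) = 1 / 2 * Real.Gamma ((k + 1) / 2) := by
  have := integral_rpow_mul_exp_neg_rpow (p := 2) (q := k) (by norm_num)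
    (by have : (0 : ℝ) ≤ k := Nat.cast_nonneg k
        linarith)
  simpa using this

theorem neg_aux {N : ℕ} (hN : 1 ≤ N) (f : Euc N → ℝ) :
    ∫ u : Metric.sphere (0 : Euc N) 1, f (-(u : Euc N)) ∂(volume : Measure (Euc N)).toSphere =
    ∫ u : Metric.sphere (0 : Euc N) 1, f u ∂(volume : Measure (Euc N)).toSphere := by
  have key : ∀ h : Euc N → ℝ, ∫ x, h (‖x‖⁻¹ • x) * Real.exp (-‖x‖ ^ 2) =
      (∫ u : Metric.sphere (0 : Euc N) 1, h u ∂(volume : Measure (Euc N)).toSphere) *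
      ∫ y in Ioi (0 : ℝ), y ^ (N - 1) * Real.exp (-y ^ 2) := by
    intro h
    apply polar_aux (fun u => h u) (fun r => Real.exp (-r ^ 2)) _ _ hN
    intro u r hr
    have hu : ‖(u : Euc N)‖ = 1 := by simp
    simp [norm_smul, abs_of_pos hr, smul_smul, hr.ne']
  have h1 := key f
  have h2 := key (fun x => f (-x))
  have h3 := integral_neg_eq_self (fun x : Euc N => f (‖x‖⁻¹ • x) * Real.exp (-‖x‖ ^ 2)) volume
  simp only [norm_neg, smul_neg] at h3
  rw [h2, h1, radial_gauss] at h3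
  refine mul_right_cancel₀ ?_ h3
  have : 0 < Real.Gamma (((N - 1 : ℕ) + 1 : ℝ) / 2) := Real.Gamma_pos_of_pos (by positivity)
  positivity

theorem gauss_abs {N : ℕ} (hN : 1 ≤ N) (e : Euc N) (he : ‖e‖ = 1) :
    ∫ x : Euc N, |⟪e, x⟫| * Real.exp (-‖x‖ ^ 2) = Real.sqrt Real.pi ^ (N - 1) := by
  obtain ⟨b, hb⟩ := Orthonormal.exists_orthonormalBasis_extension_of_card_eq (𝕜 := ℝ) (E := Euc N)
    (ι := Fin N) (by simp) (v := fun _ => e) (s := {⟨0, hN⟩}) (by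
      constructor
      · intro i; simpa using he
      · intro i j hij; exact absurd (Subsingleton.elim i j) hij)
  have hb0 : b ⟨0, hN⟩ = e := hb _ (by simp)
  have h1 := b.measurePreserving_repr_symm.integral_comp
    b.repr.symm.toHomeomorph.measurableEmbedding
    (fun x : Euc N => |⟪e, x⟫| * Real.exp (-‖x‖ ^ 2))
  rw [← h1]
  have h2 : ∀ x : Euc N, |⟪e, b.repr.symm x⟫| * Real.exp (-‖b.repr.symm x‖ ^ 2) =
      |x ⟨0, hN⟩| * Real.exp (-‖x‖ ^ 2) := by
    intro x
    rw [LinearIsometryEquiv.norm_map, ← hb0, ← b.repr_apply_apply]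
    simp
  simp_rw [h2]
  have h3 := (PiLp.volume_preserving_toLp (Fin N)).integral_comp
    (MeasurableEquiv.toLp 2 (Fin N → ℝ)).measurableEmbedding
    (fun x : Euc N => |x ⟨0, hN⟩| * Real.exp (-‖x‖ ^ 2))
  rw [← h3]
  let f : Fin N → ℝ → ℝ := fun i t => (if i = ⟨0, hN⟩ then |t| else 1) * Real.exp (-t ^ 2)
  have h4 : ∀ x : Fin N → ℝ, |(WithLp.toLp 2 x : Euc N) ⟨0, hN⟩| *
      Real.exp (-‖(WithLp.toLp 2 x : Euc N)‖ ^ 2) = ∏ i, f i (x i) := by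
    intro x
    simp only [f]
    rw [Finset.prod_mul_distrib, ← Real.exp_sum, EuclideanSpace.real_norm_sq_eq]
    simp [Finset.prod_ite_eq']
  simp_rw [h4]
  rw [integral_fintype_prod_volume_eq_prod]
  have h5 : ∫ t : ℝ, |t| * Real.exp (-t ^ 2) = 1 := by
    have := integral_comp_abs (f := fun t => t * Real.exp (-t ^ 2))
    simp only [sq_abs] at this
    rw [this]
    have h := radial_gauss 1
    simp only [pow_one] at h
    rw [h]; norm_num
  have h6 : ∫ t : ℝ, Real.exp (-t ^ 2) = Real.sqrt Real.pi := by
    simpa using integral_gaussian 1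
  have h7 : ∀ i, ∫ t, f i t = if i = ⟨0, hN⟩ then 1 else Real.sqrt Real.pi := by
    intro i
    by_cases hi : i = ⟨0, hN⟩
    · simp [f, hi, h5]
    · simp [f, hi, h6]
  simp_rw [h7]
  rw [Finset.prod_ite]
  simp [Finset.filter_ne']

theorem gauss_one {N : ℕ} :
    ∫ x : Euc N, Real.exp (-‖x‖ ^ 2) = Real.sqrt Real.pi ^ N := by
  have := GaussianFourier.integral_rexp_neg_mul_sq_norm (V := Euc N) (b := 1) one_pos
  simp only [neg_mul, one_mul, div_one, finrank_euclideanSpace, Fintype.card_fin] at this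
  rw [this, Real.sqrt_eq_rpow, ← Real.rpow_natCast, ← Real.rpow_mul Real.pi_pos.le]
  congr 1; ring

theorem gamma_aux {N : ℕ} (hN : 1 ≤ N) :
    Real.Gamma ((N + 1 : ℝ) / 2) ≤ Real.sqrt (N / 2) * Real.Gamma ((N : ℝ) / 2) := by
  have hN' : (0 : ℝ) < N := by exact_mod_cast hN
  have hG := Real.Gamma_pos_of_pos (half_pos hN')
  have h := Real.Gamma_mul_add_mul_le_rpow_Gamma_mul_rpow_Gamma (s := (N : ℝ) / 2)
    (t := (N : ℝ) / 2 + 1) (a := 1 / 2) (b := 1 / 2) (by positivity) (by positivity)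
    (by norm_num) (by norm_num) (by norm_num)
  rw [Real.Gamma_add_one (by positivity), ← Real.sqrt_eq_rpow, ← Real.sqrt_eq_rpow,
    Real.sqrt_mul (by positivity)] at h
  calc _ = Real.Gamma (1 / 2 * ((N : ℝ) / 2) + 1 / 2 * ((N : ℝ) / 2 + 1)) := by congr 1; ring
    _ ≤ _ := h
    _ = Real.sqrt (N / 2) * (Real.sqrt (Real.Gamma ((N : ℝ) / 2)) * Real.sqrt (Real.Gamma ((N : ℝ) / 2))) := by ring
    _ = _ := by rw [Real.mul_self_sqrt hG.le]

theorem toSphere_abs {N : ℕ} (hN : 1 ≤ N) (p : Euc N) :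
    3 * ‖p‖ * ((volume : Measure (Euc N)).toSphere).real univ ≤ 4 * Real.sqrt N *
    ∫ u : Metric.sphere (0 : Euc N) 1, |⟪p, (u : Euc N)⟫| ∂(volume : Measure (Euc N)).toSphere := by
  by_cases hp : p = 0
  · simp [hp]
  have hp' : 0 < ‖p‖ := norm_pos_iff.mpr hp
  set e : Euc N := ‖p‖⁻¹ • p with he
  have hpe : p = ‖p‖ • e := by rw [he, smul_smul, mul_inv_cancel₀ hp'.ne', one_smul]
  have hen : ‖e‖ = 1 := by rw [he, norm_smul]; simp [hp'.ne']
  have h0 : ∫ u : Metric.sphere (0 : Euc N) 1, |⟪p, (u : Euc N)⟫| ∂(volume : Measure (Euc N)).toSphere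
    = ‖p‖ * ∫ u : Metric.sphere (0 : Euc N) 1, |⟪e, (u : Euc N)⟫| ∂(volume : Measure (Euc N)).toSphere := by
    rw [← integral_const_mul]
    congr 1; ext u
    conv_lhs => rw [hpe]
    rw [real_inner_smul_left, abs_mul, abs_of_pos hp']
  rw [h0]
  set A := ∫ u : Metric.sphere (0 : Euc N) 1, |⟪e, (u : Euc N)⟫| ∂(volume : Measure (Euc N)).toSphere with hA
  set S := ((volume : Measure (Euc N)).toSphere).real univ with hS
  have hNs : N - 1 + 1 = N := Nat.sub_add_cancel hN
  have h1 : Real.sqrt Real.pi ^ (N - 1) = A * (1 / 2 * Real.Gamma ((N + 1 : ℝ) / 2)) := by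
    rw [← gauss_abs hN e hen, ← radial_gauss N]
    rw [polar_aux (fun u => |⟪e, (u : Euc N)⟫|) (fun r => r * Real.exp (-r ^ 2)) _ _ hN]
    · congr 2; ext y
      rw [← mul_assoc, ← pow_succ, hNs]
    · intro u r hr
      have hu : ‖(u : Euc N)‖ = 1 := by simp
      rw [real_inner_smul_right, norm_smul, hu, abs_mul, Real.norm_eq_abs, abs_of_pos hr]
      ring_nf
  have h2 : Real.sqrt Real.pi ^ N = S * (1 / 2 * Real.Gamma ((N : ℝ) / 2)) := by
    have := radial_gauss (N - 1)
    have hc : ((N - 1 : ℕ) : ℝ) + 1 = N := by exact_mod_cast hNs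
    rw [hc] at this
    rw [← gauss_one, ← this]
    rw [polar_aux (fun u => 1) (fun r => Real.exp (-r ^ 2)) _ _ hN]
    · simp [hS]
    · intro u r hr
      have hu : ‖(u : Euc N)‖ = 1 := by simp
      rw [norm_smul, hu, Real.norm_eq_abs, abs_of_pos hr]
      ring_nf
  have hN' : (0 : ℝ) < N := by exact_mod_cast hN
  have hG := Real.Gamma_pos_of_pos (half_pos hN')
  have h3 : S * Real.Gamma ((N : ℝ) / 2) = Real.sqrt Real.pi * A * Real.Gamma ((N + 1 : ℝ) / 2) := by
    have : Real.sqrt Real.pi ^ N = Real.sqrt Real.pi ^ (N - 1) * Real.sqrt Real.pi := by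
      rw [← pow_succ, hNs]
    rw [h1, h2] at this
    linarith
  have hA0 : 0 ≤ A := integral_nonneg fun u => abs_nonneg _
  have h4 : S ≤ Real.sqrt Real.pi * A * Real.sqrt (N / 2) := by
    refine le_of_mul_le_mul_right ?_ hG
    rw [h3, mul_assoc (Real.sqrt Real.pi * A)]
    exact mul_le_mul_of_nonneg_left (gamma_aux hN) (by positivity)
  have h5 : 3 * (Real.sqrt Real.pi * Real.sqrt (N / 2)) ≤ 4 * Real.sqrt N := by
    rw [← Real.sqrt_mul Real.pi_pos.le]
    have : Real.sqrt (Real.pi * (N / 2)) ≤ Real.sqrt ((16 / 9) * N) := by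
      apply Real.sqrt_le_sqrt
      nlinarith [Real.pi_lt_d2]
    rw [Real.sqrt_mul (x := 16 / 9) (by norm_num), show (16 / 9 : ℝ) = (4 / 3) ^ 2 by norm_num,
      Real.sqrt_sq (by norm_num)] at this
    linarith
  calc 3 * ‖p‖ * S ≤ 3 * ‖p‖ * (Real.sqrt Real.pi * A * Real.sqrt (N / 2)) := by gcongr
    _ = ‖p‖ * A * (3 * (Real.sqrt Real.pi * Real.sqrt (N / 2))) := by ring
    _ ≤ ‖p‖ * A * (4 * Real.sqrt N) := by gcongr
    _ = _ := by ring

theorem sphere_prob {N : ℕ} (hN : 1 ≤ N) : IsProbabilityMeasure (sphereMeasure N) := by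
  have : Nonempty (Fin N) := ⟨⟨0, hN⟩⟩
  constructor
  rw [sphereMeasure, Measure.smul_apply, smul_eq_mul]
  apply ENNReal.inv_mul_cancel
  · rw [Ne, Measure.measure_univ_eq_zero]
    exact Measure.toSphere_ne_zero _
  · exact measure_ne_top _ _

theorem sphere_integral {N : ℕ} (f : Metric.sphere (0 : Euc N) 1 → ℝ) :
    ∫ u, f u ∂(sphereMeasure N) = (((volume : Measure (Euc N)).toSphere).real univ)⁻¹ *
      ∫ u, f u ∂(volume : Measure (Euc N)).toSphere := by
  rw [sphereMeasure, integral_smul_measure, smul_eq_mul, ENNReal.toReal_inv]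
  rfl

theorem sphere_neg {N : ℕ} (hN : 1 ≤ N) (f : Euc N → ℝ) :
    ∫ u : Metric.sphere (0 : Euc N) 1, f (-(u : Euc N)) ∂(sphereMeasure N) =
    ∫ u : Metric.sphere (0 : Euc N) 1, f u ∂(sphereMeasure N) := by
  rw [sphere_integral, sphere_integral, neg_aux hN]

theorem sphere_abs {N : ℕ} (hN : 1 ≤ N) (p : Euc N) :
    3 * ‖p‖ ≤ 4 * Real.sqrt N *
    ∫ u : Metric.sphere (0 : Euc N) 1, |⟪p, (u : Euc N)⟫| ∂(sphereMeasure N) := by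
  have : Nonempty (Fin N) := ⟨⟨0, hN⟩⟩
  have hS : 0 < ((volume : Measure (Euc N)).toSphere).real univ := by
    rw [measureReal_def]
    refine ENNReal.toReal_pos ?_ (measure_ne_top _ _)
    rw [Ne, Measure.measure_univ_eq_zero]
    exact Measure.toSphere_ne_zero _
  rw [sphere_integral]
  refine le_of_mul_le_mul_right ?_ hS
  refine (toSphere_abs hN p).trans (le_of_eq ?_)
  field_simp

theorem outreach_cont {N : ℕ} {B : Set (Euc N)} (hB : IsCompact B) : Continuous (outreach B) := by
  unfold outreach
  exact hB.continuous_sSup (f := fun u b => ⟪b, u⟫) (by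
    show Continuous fun q : Euc N × Euc N => ⟪q.2, q.1⟫
    fun_prop)

theorem le_outreach {N : ℕ} {B : Set (Euc N)} (hB : IsCompact B) {p : Euc N} (hp : p ∈ B)
    (u : Euc N) : ⟪p, u⟫ ≤ outreach B u := by
  unfold outreach
  apply le_csSup
  · exact (hB.image (f := fun b => ⟪b, u⟫) (by fun_prop)).bddAbove
  · exact ⟨p, hp, rfl⟩

/-- for `N ≥ 1` and `γ ≥ 0`, every `𝓑 ∈ 𝒞^γ` satisfies
`sup_{p ∈ 𝓑} ‖p‖ ≤ 4√N(‖C‖_∞ + γ)`. -/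
theorem norm_bound_of_mem_CGamma {N : ℕ} (hN : 1 ≤ N)
    (C : Euc N → ℝ) (LC : ℝ≥0) (hC : LipschitzOnWith LC C (Metric.sphere (0 : Euc N) 1))
    (γ : ℝ) (hγ : 0 ≤ γ) (B : Set (Euc N)) (hB : B ∈ CGamma C γ) :
    sSup ((fun p : Euc N => ‖p‖) '' B) ≤ 4 * Real.sqrt N * (supNormSphere C + γ) := by
  have := sphere_prob hN
  have : Nonempty (Fin N) := ⟨⟨0, hN⟩⟩
  obtain ⟨⟨hne, hconv, hcomp, hfeas⟩, hopt⟩ := hB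
  set c := supNormSphere C with hc
  have hbdd : BddAbove (Set.range fun x : Metric.sphere (0 : Euc N) 1 => |C x|) := by
    have := ((isCompact_sphere (0 : Euc N) 1).image_of_continuousOn hC.continuousOn.abs).bddAbove
    refine this.mono ?_
    rintro _ ⟨x, rfl⟩
    exact ⟨x, x.2, rfl⟩
  have hCc : ∀ x : Metric.sphere (0 : Euc N) 1, |C x| ≤ c := fun x => le_ciSup hbdd x
  have hc0 : 0 ≤ c := Real.iSup_nonneg fun x => abs_nonneg _
  have hIntg : ∀ f : Euc N → ℝ, Continuous f →
      Integrable (fun u : Metric.sphere (0 : Euc N) 1 => f u) (sphereMeasure N) := by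
    intro f hf
    exact (hf.comp continuous_subtype_val).integrable_of_hasCompactSupport
      (HasCompactSupport.of_compactSpace _)
  -- value of the closed ball
  have hball : ∀ u : Metric.sphere (0 : Euc N) 1,
      outreach (closedBall (0 : Euc N) c) (u : Euc N) = c := by
    intro u
    have hu : ‖(u : Euc N)‖ = 1 := by simp
    apply le_antisymm
    · apply csSup_le ((nonempty_closedBall.mpr hc0).image _)
      rintro _ ⟨b, hb, rfl⟩
      have h1 := real_inner_le_norm b (u : Euc N)
      rw [hu, mul_one] at h1
      exact h1.trans (by simpa using hb)
    · have h1 := le_outreach (isCompact_closedBall (0 : Euc N) c) (p := c • (u : Euc N))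
        (by simp [norm_smul, abs_of_nonneg hc0]) (u : Euc N)
      rw [real_inner_smul_left, real_inner_self_eq_norm_sq, hu] at h1
      linarith
  have hballmem : closedBall (0 : Euc N) c ∈ CInf C := by
    refine ⟨nonempty_closedBall.mpr hc0, convex_closedBall _ _, isCompact_closedBall _ _, ?_⟩
    intro u hu
    rw [hball ⟨u, hu⟩]
    exact (le_abs_self _).trans (hCc ⟨u, hu⟩)
  have hV : VCP C ≤ c := by
    unfold VCP
    by_cases hbb : BddBelow (meanHalfWidth '' CInf C)
    · refine csInf_le hbb ⟨_, hballmem, ?_⟩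
      unfold meanHalfWidth
      simp_rw [hball]
      simp
    · rw [Real.sInf_of_not_bddBelow hbb]
      exact hc0
  have hM : meanHalfWidth B ≤ c + γ := by linarith
  apply csSup_le (hne.image _)
  rintro _ ⟨p, hp, rfl⟩
  have hoi := hIntg _ (outreach_cont hcomp)
  have hoin := hIntg (fun u => outreach B (-u)) ((outreach_cont hcomp).comp continuous_neg)
  have hai := hIntg (fun u => |⟪p, u⟫|) (by fun_prop)
  have hpair : ∫ u : Metric.sphere (0 : Euc N) 1, (|⟪p, (u : Euc N)⟫| - c) ∂(sphereMeasure N) ≤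
      ∫ u : Metric.sphere (0 : Euc N) 1, (outreach B u + outreach B (-u)) ∂(sphereMeasure N) := by
    refine integral_mono (hai.sub (integrable_const c)) (hoi.add hoin) ?_
    intro u
    have hmem : -(u : Euc N) ∈ Metric.sphere (0 : Euc N) 1 := by simp
    have h1 := le_outreach hcomp hp (u : Euc N)
    have h2 := le_outreach hcomp hp (-(u : Euc N))
    rw [inner_neg_right] at h2
    have h3 := hfeas u u.2
    have h4 := hfeas _ hmem
    have h5 := neg_le_of_abs_le (hCc u)
    have h6 := neg_le_of_abs_le (hCc ⟨_, hmem⟩)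
    simp only at h6 ⊢
    rcases abs_cases ⟪p, (u : Euc N)⟫ with ⟨h, _⟩ | ⟨h, _⟩ <;> rw [h] <;> linarith
  rw [integral_sub hai (integrable_const c), integral_add hoi hoin, sphere_neg hN (outreach B)] at hpair
  simp only [integral_const, probReal_univ, one_smul] at hpair
  have hM' : ∫ u : Metric.sphere (0 : Euc N) 1, outreach B u ∂(sphereMeasure N) ≤ c + γ := hM
  have hfin := sphere_abs hN p
  have hs : 0 ≤ Real.sqrt N := Real.sqrt_nonneg _
  have : 4 * Real.sqrt N * (∫ u : Metric.sphere (0 : Euc N) 1, |⟪p, (u : Euc N)⟫| ∂(sphereMeasure N))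
      ≤ 4 * Real.sqrt N * (3 * (c + γ)) := by
    gcongr
    linarith
  show ‖p‖ ≤ _
  linarith
end
end

section
/- Let N ≥ 2, let {(u_i,w_i)}_{i=1}^m ⊆ S^{N-1} × [0,∞) be an ε-accurate quadrature, let 𝒮 = {u_i}_{i=1}^m have dispersion δ = disp(𝒮), and assume ε, δ ≤ 1/(10√N). Then for every γ ≥ 0 the collection 𝒟^γ is compact as a subset of the space of nonempty compact subsets of ℝ^N equipped with the Hausdorff distance d_H. -/
open MeasureTheory Metric Set TopologicalSpace Filter
open scoped RealInnerProductSpace NNReal ENNReal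

noncomputable section

section Helpers

lemma exists_close {N : ℕ} {K L : NonemptyCompacts (Euc N)} {r : ℝ} (h : dist K L < r)
    {x : Euc N} (hx : x ∈ (K : Set (Euc N))) : ∃ y ∈ (L : Set (Euc N)), dist x y < r := by
  rw [NonemptyCompacts.dist_eq] at h
  exact exists_dist_lt_of_hausdorffDist_lt hx h
    (hausdorffEDist_ne_top_of_nonempty_of_bounded K.nonempty L.nonempty
      K.isCompact.isBounded L.isCompact.isBounded)

lemma outreach_bdd {N : ℕ} (K : NonemptyCompacts (Euc N)) (u : Euc N) :
    BddAbove ((fun b => ⟪b, u⟫) '' (K : Set (Euc N))) :=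
  (K.isCompact.image (by fun_prop)).bddAbove

lemma le_outreach_s12 {N : ℕ} (K : NonemptyCompacts (Euc N)) (u : Euc N) {b : Euc N}
    (hb : b ∈ (K : Set (Euc N))) : ⟪b, u⟫ ≤ outreach (K : Set (Euc N)) u :=
  le_csSup (outreach_bdd K u) ⟨b, hb, rfl⟩

lemma outreach_le_add {N : ℕ} (K L : NonemptyCompacts (Euc N)) {u : Euc N} (hu : ‖u‖ = 1) :
    outreach (K : Set (Euc N)) u ≤ outreach (L : Set (Euc N)) u + dist K L := by
  apply le_of_forall_pos_le_add
  intro η hη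
  apply csSup_le (K.nonempty.image _)
  rintro _ ⟨x, hx, rfl⟩
  obtain ⟨y, hy, hxy⟩ := exists_close (lt_add_of_pos_right (dist K L) hη) hx
  have h1 := le_outreach_s12 L u hy
  have h2 : ⟪x - y, u⟫ ≤ ‖x - y‖ * ‖u‖ := real_inner_le_norm _ _
  rw [inner_sub_left, hu, ← dist_eq_norm] at h2
  dsimp only
  linarith

lemma outreach_continuous {N : ℕ} {u : Euc N} (hu : ‖u‖ = 1) :
    Continuous (fun K : NonemptyCompacts (Euc N) => outreach (K : Set (Euc N)) u) := by
  have : LipschitzWith 1 (fun K : NonemptyCompacts (Euc N) => outreach (K : Set (Euc N)) u) :=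
    LipschitzWith.of_le_add fun K L => outreach_le_add K L hu
  exact this.continuous

lemma isClosed_convex {N : ℕ} :
    IsClosed {K : NonemptyCompacts (Euc N) | Convex ℝ (K : Set (Euc N))} := by
  apply isClosed_of_closure_subset
  intro L hL
  rw [Metric.mem_closure_iff] at hL
  intro x hx y hy a b ha hb hab
  rw [← L.isCompact.isClosed.closure_eq, Metric.mem_closure_iff]
  intro η hη
  obtain ⟨K, hK, hLK⟩ := hL (η / 2) (by positivity)
  obtain ⟨x', hx', hxx⟩ := exists_close hLK hx
  obtain ⟨y', hy', hyy⟩ := exists_close hLK hy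
  rw [dist_comm] at hLK
  obtain ⟨z, hz, hzz⟩ := exists_close hLK (hK hx' hy' ha hb hab)
  refine ⟨z, hz, ?_⟩
  have h1 : dist (a • x + b • y) (a • x' + b • y') ≤ a * dist x x' + b * dist y y' := by
    refine (dist_add_add_le _ _ _ _).trans ?_
    rw [dist_smul₀, dist_smul₀, Real.norm_of_nonneg ha, Real.norm_of_nonneg hb]
  have h2 := dist_triangle (a • x + b • y) (a • x' + b • y') z
  have h3 : a * dist x x' + b * dist y y' ≤ a * (η / 2) + b * (η / 2) := by gcongr
  have h4 : a * (η / 2) + b * (η / 2) = η / 2 := by rw [← add_mul, hab, one_mul]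
  linarith

/-! ### the sphere measure -/

lemma sphereMeasure_prob {N : ℕ} (hN : 2 ≤ N) : IsProbabilityMeasure (sphereMeasure N) := by
  have : Nonempty (Fin N) := ⟨⟨0, by omega⟩⟩
  have : Nontrivial (Euc N) := inferInstance
  refine ⟨?_⟩
  unfold sphereMeasure
  rw [Measure.smul_apply, smul_eq_mul]
  apply ENNReal.inv_mul_cancel
  · rw [Ne, Measure.measure_univ_eq_zero]
    exact Measure.toSphere_ne_zero _
  · exact measure_ne_top _ _

/-- action of a linear isometry on the sphere -/
def sphMap {N : ℕ} (e : Euc N ≃ₗᵢ[ℝ] Euc N) (x : Metric.sphere (0 : Euc N) 1) :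
    Metric.sphere (0 : Euc N) 1 :=
  ⟨e x, by simp⟩

lemma sphMap_cont {N : ℕ} (e : Euc N ≃ₗᵢ[ℝ] Euc N) : Continuous (sphMap e) := by
  unfold sphMap
  exact Continuous.subtype_mk (e.continuous.comp continuous_subtype_val) _

open scoped Pointwise in
lemma sphMap_toSphere {N : ℕ} (e : Euc N ≃ₗᵢ[ℝ] Euc N) :
    MeasurePreserving (sphMap e) (volume : Measure (Euc N)).toSphere
      (volume : Measure (Euc N)).toSphere := by
  refine ⟨(sphMap_cont e).measurable, ?_⟩
  ext s hs
  rw [Measure.map_apply (sphMap_cont e).measurable hs,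
    Measure.toSphere_apply' _ ((sphMap_cont e).measurable hs), Measure.toSphere_apply' _ hs]
  congr 1
  have key : Ioo (0 : ℝ) 1 • ((↑) '' (sphMap e ⁻¹' s) : Set (Euc N))
      = e ⁻¹' (Ioo (0 : ℝ) 1 • ((↑) '' s : Set (Euc N))) := by
    ext z
    simp only [Set.mem_smul, Set.mem_image, Set.mem_preimage]
    constructor
    · rintro ⟨r, hr, _, ⟨x, hx, rfl⟩, rfl⟩
      exact ⟨r, hr, _, ⟨_, hx, rfl⟩, by simp [sphMap]⟩
    · rintro ⟨r, hr, _, ⟨x, hx, rfl⟩, h⟩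
      refine ⟨r, hr, _, ⟨sphMap e.symm x, ?_, rfl⟩, ?_⟩
      · have : sphMap e (sphMap e.symm x) = x := by
          apply Subtype.ext
          simp [sphMap]
        rwa [this]
      · apply e.injective
        rw [← h]
        simp [sphMap]
  rw [key]
  exact (e.measurePreserving).measure_preimage_equiv (f := e.toMeasurableEquiv) _

lemma sphere_integral_inv {N : ℕ} (e : Euc N ≃ₗᵢ[ℝ] Euc N) (f : Euc N → ℝ) :
    ∫ x : Metric.sphere (0 : Euc N) 1, f (e x) ∂(sphereMeasure N)
      = ∫ x : Metric.sphere (0 : Euc N) 1, f x ∂(sphereMeasure N) := by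
  unfold sphereMeasure
  rw [integral_smul_measure, integral_smul_measure]
  congr 1
  let h : Metric.sphere (0 : Euc N) 1 ≃ₜ Metric.sphere (0 : Euc N) 1 :=
    { toFun := sphMap e
      invFun := sphMap e.symm
      left_inv := fun x => Subtype.ext (by simp [sphMap])
      right_inv := fun x => Subtype.ext (by simp [sphMap])
      continuous_toFun := sphMap_cont e
      continuous_invFun := sphMap_cont e.symm }
  exact (sphMap_toSphere e).integral_comp h.measurableEmbedding
    (fun x : Metric.sphere (0 : Euc N) 1 => f x)

lemma sphere_integral_dir {N : ℕ} (g : ℝ → ℝ) {b c : Euc N} (h : ‖b‖ = ‖c‖) :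
    ∫ x : Metric.sphere (0 : Euc N) 1, g ⟪b, (x : Euc N)⟫ ∂(sphereMeasure N)
      = ∫ x : Metric.sphere (0 : Euc N) 1, g ⟪c, (x : Euc N)⟫ ∂(sphereMeasure N) := by
  set e : Euc N ≃ₗᵢ[ℝ] Euc N := (ℝ ∙ (b - c))ᗮ.reflection
  have he : e b = c := Submodule.reflection_sub h
  rw [← sphere_integral_inv e (fun x => g ⟪c, x⟫)]
  simp only [← he, LinearIsometryEquiv.inner_map_map]

lemma sph_int {N : ℕ} (hN : 2 ≤ N) {f : Euc N → ℝ} (hf : Continuous f) :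
    Integrable (fun x : Metric.sphere (0 : Euc N) 1 => f x) (sphereMeasure N) := by
  have := sphereMeasure_prob hN
  have hc : Continuous (fun x : Metric.sphere (0 : Euc N) 1 => f x) :=
    hf.comp continuous_subtype_val
  have : CompactSpace (Metric.sphere (0 : Euc N) 1) :=
    isCompact_iff_compactSpace.mp (isCompact_sphere _ _)
  exact hc.integrable_of_hasCompactSupport (HasCompactSupport.of_compactSpace _)

lemma coord_eq {N : ℕ} (i : Fin N) (x : Euc N) :
    ⟪(EuclideanSpace.single i (1 : ℝ) : Euc N), x⟫ = x i := by
  simp [EuclideanSpace.inner_single_left]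

lemma sum_sq {N : ℕ} (x : Metric.sphere (0 : Euc N) 1) : ∑ i, ((x : Euc N) i) ^ 2 = 1 := by
  have h := EuclideanSpace.real_norm_sq_eq (x : Euc N)
  have h1 : ‖(x : Euc N)‖ = 1 := by simp
  rw [h1] at h
  linarith

lemma moment_coord {N : ℕ} (k : ℕ) (i j : Fin N) :
    ∫ x : Metric.sphere (0 : Euc N) 1, ((x : Euc N) i) ^ k ∂(sphereMeasure N)
      = ∫ x : Metric.sphere (0 : Euc N) 1, ((x : Euc N) j) ^ k ∂(sphereMeasure N) := by
  have h := sphere_integral_dir (N := N) (fun t => t ^ k)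
    (b := EuclideanSpace.single i (1 : ℝ)) (c := EuclideanSpace.single j (1 : ℝ)) (by simp)
  simpa only [coord_eq] using h

lemma moment_two {N : ℕ} (hN : 2 ≤ N) (i : Fin N) :
    N * ∫ x : Metric.sphere (0 : Euc N) 1, ((x : Euc N) i) ^ 2 ∂(sphereMeasure N) = 1 := by
  have := sphereMeasure_prob hN
  have h : ∫ x : Metric.sphere (0 : Euc N) 1, ∑ j, ((x : Euc N) j) ^ 2 ∂(sphereMeasure N) = 1 := by
    simp only [sum_sq]
    simp
  rw [integral_finsetSum _ (fun j _ => sph_int hN (f := fun x => x j ^ 2) (by fun_prop))] at h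
  rw [Finset.sum_congr rfl (fun j _ => moment_coord 2 j i)] at h
  simpa using h

lemma moment_mixed {N : ℕ} (hN : 2 ≤ N) (i j : Fin N) :
    (∫ x : Metric.sphere (0 : Euc N) 1, ((x : Euc N) i) ^ 4 ∂(sphereMeasure N)) / 3 ≤
      ∫ x : Metric.sphere (0 : Euc N) 1, ((x : Euc N) i) ^ 2 * ((x : Euc N) j) ^ 2
        ∂(sphereMeasure N) := by
  have hA : 0 ≤ ∫ x : Metric.sphere (0 : Euc N) 1, ((x : Euc N) i) ^ 4 ∂(sphereMeasure N) :=
    integral_nonneg fun x => by positivity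
  by_cases hij : i = j
  · subst hij
    have : ∀ x : Metric.sphere (0 : Euc N) 1,
        ((x : Euc N) i) ^ 2 * ((x : Euc N) i) ^ 2 = ((x : Euc N) i) ^ 4 := fun x => by ring
    simp only [this]
    linarith
  let ei : Euc N := EuclideanSpace.single i (1 : ℝ)
  let ej : Euc N := EuclideanSpace.single j (1 : ℝ)
  have hi : ‖ei‖ = 1 := by simp [ei]
  have hj : ‖ej‖ = 1 := by simp [ej]
  have h0 : ⟪ei, ej⟫ = 0 := by
    simp [ei, ej, EuclideanSpace.inner_single_left, hij]
  have hs : ‖(√2 : ℝ) • ei‖ = √2 := by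
    rw [norm_smul, hi, mul_one, Real.norm_of_nonneg (Real.sqrt_nonneg _)]
  have hp : ‖ei + ej‖ = √2 := by
    rw [eq_comm, Real.sqrt_eq_iff_mul_self_eq_of_pos (by
      rw [norm_pos_iff]; intro h
      have : ⟪ei, ei + ej⟫ = 0 := by rw [h]; simp
      rw [inner_add_right, h0, real_inner_self_eq_norm_sq, hi] at this
      norm_num at this)]
    have := norm_add_sq_real ei ej
    rw [h0, hi, hj] at this
    nlinarith
  have hm : ‖ei - ej‖ = √2 := by
    rw [eq_comm, Real.sqrt_eq_iff_mul_self_eq_of_pos (by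
      rw [norm_pos_iff]; intro h
      have : ⟪ei, ei - ej⟫ = 0 := by rw [h]; simp
      rw [inner_sub_right, h0, real_inner_self_eq_norm_sq, hi] at this
      norm_num at this)]
    have := norm_sub_sq_real ei ej
    rw [h0, hi, hj] at this
    nlinarith
  have e1 := sphere_integral_dir (N := N) (fun t => t ^ 4) (hp.trans hs.symm)
  have e2 := sphere_integral_dir (N := N) (fun t => t ^ 4) (hm.trans hs.symm)
  simp only [inner_add_left, inner_sub_left, inner_smul_left, ei, ej, coord_eq,
    conj_trivial, mul_pow] at e1 e2
  have s4 : (√2 : ℝ) ^ 4 = 4 := by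
    have : (√2 : ℝ) ^ 2 = 2 := Real.sq_sqrt (by norm_num)
    calc (√2 : ℝ) ^ 4 = ((√2 : ℝ) ^ 2) ^ 2 := by ring
      _ = 4 := by rw [this]; norm_num
  rw [integral_const_mul, s4] at e1 e2
  have e3 := moment_coord 4 j i
  have c1 : Integrable (fun x : Metric.sphere (0 : Euc N) 1 =>
      ((x : Euc N) i + (x : Euc N) j) ^ 4) (sphereMeasure N) :=
    sph_int hN (f := fun x => (x i + x j) ^ 4) (by fun_prop)
  have c2 : Integrable (fun x : Metric.sphere (0 : Euc N) 1 =>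
      ((x : Euc N) i - (x : Euc N) j) ^ 4) (sphereMeasure N) :=
    sph_int hN (f := fun x => (x i - x j) ^ 4) (by fun_prop)
  have c3 : Integrable (fun x : Metric.sphere (0 : Euc N) 1 =>
      2 * ((x : Euc N) i) ^ 4) (sphereMeasure N) :=
    sph_int hN (f := fun x => 2 * x i ^ 4) (by fun_prop)
  have c4 : Integrable (fun x : Metric.sphere (0 : Euc N) 1 =>
      2 * ((x : Euc N) j) ^ 4) (sphereMeasure N) :=
    sph_int hN (f := fun x => 2 * x j ^ 4) (by fun_prop)
  have c5 : Integrable (fun x : Metric.sphere (0 : Euc N) 1 =>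
      12 * (((x : Euc N) i) ^ 2 * ((x : Euc N) j) ^ 2)) (sphereMeasure N) :=
    sph_int hN (f := fun x => 12 * (x i ^ 2 * x j ^ 2)) (by fun_prop)
  have e4 := integral_add c1 c2
  have e5 := integral_add (c3.add c4) c5
  have e6 := integral_add c3 c4
  simp only [Pi.add_apply] at e5
  rw [e6, integral_const_mul, integral_const_mul, integral_const_mul] at e5
  have e7 : ∀ x : Metric.sphere (0 : Euc N) 1,
      ((x : Euc N) i + (x : Euc N) j) ^ 4 + ((x : Euc N) i - (x : Euc N) j) ^ 4
      = 2 * ((x : Euc N) i) ^ 4 + 2 * ((x : Euc N) j) ^ 4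
        + 12 * (((x : Euc N) i) ^ 2 * ((x : Euc N) j) ^ 2) := fun x => by ring
  simp only [e7] at e4
  linarith

lemma moment_four {N : ℕ} (hN : 2 ≤ N) (i : Fin N) :
    (N : ℝ) ^ 2 * ∫ x : Metric.sphere (0 : Euc N) 1, ((x : Euc N) i) ^ 4 ∂(sphereMeasure N)
      ≤ 3 := by
  have := sphereMeasure_prob hN
  set A := ∫ x : Metric.sphere (0 : Euc N) 1, ((x : Euc N) i) ^ 4 ∂(sphereMeasure N) with hA
  have h : ∫ x : Metric.sphere (0 : Euc N) 1, ∑ j, ∑ k, ((x : Euc N) j) ^ 2 * ((x : Euc N) k) ^ 2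
      ∂(sphereMeasure N) = 1 := by
    simp only [← Finset.mul_sum, sum_sq, mul_one]
    simp
  rw [integral_finsetSum _ (fun j _ => sph_int hN (f := fun x => ∑ k, x j ^ 2 * x k ^ 2)
    (by fun_prop))] at h
  have h2 : ∑ j : Fin N, ∑ k : Fin N, A / 3 ≤ 1 := by
    rw [← h]
    apply Finset.sum_le_sum
    intro j _
    rw [integral_finsetSum _ (fun k _ => sph_int hN (f := fun x => x j ^ 2 * x k ^ 2)
      (by fun_prop))]
    apply Finset.sum_le_sum
    intro k _
    have := moment_mixed hN j k
    rwa [moment_coord 4 j i] at this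
  simp only [Finset.sum_const, Finset.card_univ, Fintype.card_fin, nsmul_eq_mul] at h2
  nlinarith

lemma abs_moment {N : ℕ} (hN : 2 ≤ N) (i : Fin N) :
    5 / 9 ≤ √N * ∫ x : Metric.sphere (0 : Euc N) 1, |(x : Euc N) i| ∂(sphereMeasure N) := by
  have hpt : ∀ t : ℝ, N * t ^ 2 - 4 / 27 * ((N : ℝ) ^ 2 * t ^ 4) ≤ √N * |t| := by
    intro t
    set s := √N * |t| with hs
    have hs0 : 0 ≤ s := by positivity
    have h2 : N * t ^ 2 = s ^ 2 := by
      rw [hs, mul_pow, Real.sq_sqrt (by positivity), sq_abs]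
    have h4 : (N : ℝ) ^ 2 * t ^ 4 = s ^ 4 := by
      calc (N : ℝ) ^ 2 * t ^ 4 = (N * t ^ 2) ^ 2 := by ring
        _ = s ^ 4 := by rw [h2]; ring
    rw [h2, h4]
    have : 0 ≤ s * ((s - 3 / 2) ^ 2 * (s + 3)) := by positivity
    nlinarith
  have c1 : Integrable (fun x : Metric.sphere (0 : Euc N) 1 =>
      N * ((x : Euc N) i) ^ 2) (sphereMeasure N) :=
    sph_int hN (f := fun x => N * x i ^ 2) (by fun_prop)
  have c2 : Integrable (fun x : Metric.sphere (0 : Euc N) 1 =>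
      4 / 27 * ((N : ℝ) ^ 2 * ((x : Euc N) i) ^ 4)) (sphereMeasure N) :=
    sph_int hN (f := fun x => 4 / 27 * ((N : ℝ) ^ 2 * x i ^ 4)) (by fun_prop)
  have c3 : Integrable (fun x : Metric.sphere (0 : Euc N) 1 =>
      √N * |(x : Euc N) i|) (sphereMeasure N) :=
    sph_int hN (f := fun x => √N * |x i|) (by fun_prop)
  have h := integral_mono (c1.sub c2) c3 (fun x => hpt ((x : Euc N) i))
  simp only [Pi.sub_apply] at h
  rw [integral_sub c1 c2, integral_const_mul, integral_const_mul, integral_const_mul,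
    integral_const_mul, moment_two hN i] at h
  have := moment_four hN i
  linarith

lemma pos_moment {N : ℕ} (hN : 2 ≤ N) (b : Euc N) :
    5 / 18 * ‖b‖ ≤
      √N * ∫ x : Metric.sphere (0 : Euc N) 1, max ⟪b, (x : Euc N)⟫ 0 ∂(sphereMeasure N) := by
  let i : Fin N := ⟨0, by omega⟩
  have h1 := sphere_integral_dir (N := N) (fun t => max t 0) (b := -b) (c := b) (by simp)
  have h2 := sphere_integral_dir (N := N) (fun t => |t|) (b := b)
    (c := ‖b‖ • (EuclideanSpace.single i (1 : ℝ))) (by simp [norm_smul])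
  simp only [inner_smul_left, conj_trivial, coord_eq, abs_mul, abs_norm] at h2
  rw [integral_const_mul] at h2
  have c1 : Integrable (fun x : Metric.sphere (0 : Euc N) 1 =>
      max ⟪b, (x : Euc N)⟫ 0) (sphereMeasure N) :=
    sph_int hN (f := fun x => max ⟪b, x⟫ 0) (by fun_prop)
  have c2 : Integrable (fun x : Metric.sphere (0 : Euc N) 1 =>
      max ⟪-b, (x : Euc N)⟫ 0) (sphereMeasure N) :=
    sph_int hN (f := fun x => max ⟪-b, x⟫ 0) (by fun_prop)
  have h3 := integral_add c1 c2
  have h4 : ∀ x : Metric.sphere (0 : Euc N) 1,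
      max ⟪b, (x : Euc N)⟫ 0 + max ⟪-b, (x : Euc N)⟫ 0 = |⟪b, (x : Euc N)⟫| := by
    intro x
    rw [inner_neg_left]
    exact max_zero_add_max_neg_zero_eq_abs_self _
  simp only [h4] at h3
  have h5 := mul_le_mul_of_nonneg_left (abs_moment hN i) (norm_nonneg b)
  rw [h1] at h3
  have h6 : √N * (‖b‖ * ∫ x : Metric.sphere (0 : Euc N) 1, |(x : Euc N) i| ∂(sphereMeasure N))
    = √N * (2 * ∫ x : Metric.sphere (0 : Euc N) 1, max ⟪b, (x : Euc N)⟫ 0 ∂(sphereMeasure N)) := by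
    rw [← h2, h3]; ring
  linarith

lemma norm_bound {N m : ℕ} (hN : 2 ≤ N) (u : Fin m → Euc N) (w : Fin m → ℝ) (ε : ℝ)
    (hq : IsAccurateQuadrature u w ε) (hε : ε ≤ 1 / (10 * Real.sqrt N))
    (M T : ℝ) (hM : 0 ≤ M) (K : NonemptyCompacts (Euc N))
    (hK : ∀ i, -M ≤ outreach (K : Set (Euc N)) (u i))
    (hT : quadSum u w (K : Set (Euc N)) ≤ T) {b : Euc N} (hb : b ∈ (K : Set (Euc N))) :
    ‖b‖ ≤ max M (90 / 7 * √N * (T + M)) := by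
  have := sphereMeasure_prob hN
  by_cases hbM : ‖b‖ ≤ M
  · exact hbM.trans (le_max_left _ _)
  push Not at hbM
  apply le_max_of_le_right
  obtain ⟨hu, hw, hq⟩ := hq
  have hN0 : (0 : ℝ) < √N := Real.sqrt_pos.mpr (by positivity)
  let f : Euc N → ℝ := fun x => max ⟪b, x⟫ (-M)
  have hlin : LipschitzWith ‖b‖₊ (fun x : Euc N => ⟪b, x⟫) := by
    apply LipschitzWith.of_dist_le_mul
    intro x y
    rw [Real.dist_eq, ← inner_sub_right, dist_eq_norm]
    exact abs_real_inner_le_norm _ _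
  have hfL : LipschitzWith ‖b‖₊ f := hlin.max_const (-M)
  have h1 := hq _ f hfL.lipschitzOnWith
  have hne : Nonempty (Metric.sphere (0 : Euc N) 1) :=
    ⟨⟨EuclideanSpace.single ⟨0, by omega⟩ (1 : ℝ), by simp⟩⟩
  have hsup : supNormSphere f ≤ ‖b‖ := by
    apply ciSup_le
    intro x
    have hx : ‖(x : Euc N)‖ = 1 := by simp
    have h := abs_real_inner_le_norm b (x : Euc N)
    rw [hx, mul_one, abs_le] at h
    rw [abs_le]
    exact ⟨h.1.trans (le_max_left _ _), max_le h.2 (by linarith [norm_nonneg b])⟩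
  have hsup0 : 0 ≤ supNormSphere f := Real.iSup_nonneg fun x => abs_nonneg _
  have h2 : ε * (‖b‖₊ + supNormSphere f) ≤ 1 / (10 * √N) * (2 * ‖b‖) := by
    rw [coe_nnnorm]
    have : 0 ≤ ‖b‖ + supNormSphere f := by positivity
    calc _ ≤ 1 / (10 * √N) * (‖b‖ + supNormSphere f) := by gcongr
      _ ≤ _ := by gcongr; linarith
  have h3 : ∑ i, w i * f (u i) ≤ T := by
    refine le_trans (Finset.sum_le_sum fun i _ => ?_) hT
    exact mul_le_mul_of_nonneg_left (max_le (le_outreach_s12 K _ hb) (hK i)) (hw i)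
  have c1 : Integrable (fun x : Metric.sphere (0 : Euc N) 1 =>
      max ⟪b, (x : Euc N)⟫ 0) (sphereMeasure N) :=
    sph_int hN (f := fun x => max ⟪b, x⟫ 0) (by fun_prop)
  have c2 : Integrable (fun x : Metric.sphere (0 : Euc N) 1 => f x) (sphereMeasure N) :=
    sph_int hN hfL.continuous
  have h4 := integral_mono (c1.sub (integrable_const M)) c2 (fun x => by
    simp only [Pi.sub_apply, f]
    rw [sub_le_iff_le_add, max_le_iff]
    constructor
    · linarith [le_max_left ⟪b, (x : Euc N)⟫ (-M)]
    · linarith [le_max_right ⟪b, (x : Euc N)⟫ (-M)])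
  simp only [Pi.sub_apply] at h4
  rw [integral_sub c1 (integrable_const M)] at h4
  simp only [integral_const, probReal_univ, smul_eq_mul, one_mul] at h4
  have h5 := pos_moment hN b
  have h6 := (abs_le.mp h1).2
  have h7 : ∫ x : Metric.sphere (0 : Euc N) 1, max ⟪b, (x : Euc N)⟫ 0 ∂(sphereMeasure N)
      ≤ T + M + 1 / (10 * √N) * (2 * ‖b‖) := by linarith
  have h8 := mul_le_mul_of_nonneg_left h7 hN0.le
  have h9 : √N * (T + M + 1 / (10 * √N) * (2 * ‖b‖)) = √N * (T + M) + ‖b‖ / 5 := by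
    field_simp
    ring
  rw [h9] at h8
  linarith

end Helpers

/-- under the standing assumptions on the quadrature, each `𝒟^γ` (γ ≥ 0)
is compact in the space of nonempty compact subsets of `ℝ^N` with the Hausdorff
distance. -/
theorem DGamma_compact {N m : ℕ} (hN : 2 ≤ N)
    (u : Fin m → Euc N) (w : Fin m → ℝ) (ε : ℝ)
    (hq : IsAccurateQuadrature u w ε)
    (δ : ℝ) (hδ : δ = dispersion (Set.range u))
    (hε : ε ≤ 1 / (10 * Real.sqrt N)) (hδ' : δ ≤ 1 / (10 * Real.sqrt N))
    (C : Euc N → ℝ) (LC : ℝ≥0) (hC : LipschitzOnWith LC C (Metric.sphere (0 : Euc N) 1)) :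
    ∀ γ : ℝ, 0 ≤ γ →
      IsCompact {K : NonemptyCompacts (Euc N) | (K : Set (Euc N)) ∈ DGamma u w C γ} := by
  intro γ _
  have hu : ∀ i, ‖u i‖ = 1 := fun i => by simpa using hq.1 i
  set M : ℝ := ∑ i, |C (u i)| with hMdef
  have hM : 0 ≤ M := Finset.sum_nonneg fun i _ => abs_nonneg _
  set T : ℝ := VDP u w C + γ with hT
  have hcomp := NonemptyCompacts.isCompact_subsets_of_isCompact
    (isCompact_closedBall (0 : Euc N) (max M (90 / 7 * √N * (T + M))))
  have hEq : {K : NonemptyCompacts (Euc N) | (K : Set (Euc N)) ∈ DGamma u w C γ}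
      = {K : NonemptyCompacts (Euc N) | Convex ℝ (K : Set (Euc N))} ∩
        ({K : NonemptyCompacts (Euc N) | ∀ i, C (u i) ≤ outreach (K : Set (Euc N)) (u i)} ∩
        {K : NonemptyCompacts (Euc N) | quadSum u w (K : Set (Euc N)) ≤ T}) := by
    ext K
    simp only [DGamma, DInf, Set.mem_ofPred_eq, Set.mem_inter_iff, Set.forall_mem_range]
    constructor
    · rintro ⟨⟨_, h1, _, h2⟩, h3⟩
      exact ⟨h1, h2, by linarith⟩
    · rintro ⟨h1, h2, h3⟩
      exact ⟨⟨K.nonempty, h1, K.isCompact, h2⟩, by linarith⟩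
  refine hcomp.of_isClosed_subset ?_ ?_
  · rw [hEq]
    refine isClosed_convex.inter (IsClosed.inter ?_ ?_)
    · simp only [Set.setOf_forall]
      exact isClosed_iInter fun i => isClosed_le continuous_const (outreach_continuous (hu i))
    · refine isClosed_le ?_ continuous_const
      exact continuous_finsetSum _ fun i _ => continuous_const.mul (outreach_continuous (hu i))
  · intro K hK
    rw [hEq] at hK
    intro b hb
    rw [mem_closedBall_zero_iff]
    refine norm_bound hN u w ε hq hε M T hM K (fun i => ?_) hK.2.2 hb
    have h1 := hK.2.1 i
    have h2 : |C (u i)| ≤ M :=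
      Finset.single_le_sum (f := fun i => |C (u i)|) (fun i _ => abs_nonneg _) (Finset.mem_univ i)
    linarith [neg_abs_le (C (u i))]
end
end
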